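/- Let e ≥ 0 be an integer and let h be an F_2-linear bijection of K_m. For a ∈ K_m, a ≠ 0, let r_a = m − dim_{F_2}{ y ∈ K_m : Tr_{2^m/2}(a·(x^{2^e}h(y) + y^{2^e}h(x))) = 0 for all x ∈ K_m } (the rank of the quadratic Boolean function H_a(x) = Tr_{2^m/2}(a·x^{2^e}h(x))). Assume the set E = {a ∈ K_m, a ≠ 0 : r_a is even} is nonempty and let r = min{r_a : a ∈ E}. Define F : F_{2^n} → F_{2^n} by F(x) = x^{2^e}·h(Tr_{2^n/2^m}(x)). Then N_F = 2^{n−1} − 2^{n−r/2−1}, N_F ≤ 2^{n−1} − 2^{⌊3n/4⌋}, and equality N_F = 2^{n−1} − 2^{⌊3n/4⌋} holds if and only if r = m − 2 when m is even, respectively r = m − 1 when m is odd. -/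

import Mathlib

open scoped Classical BigOperators

noncomputable section

/-- The finite field with `2^k` elements. -/
abbrev GF (k : ℕ) := GaloisField 2 k

noncomputable instance (k : ℕ) : Fintype (GF k) := Fintype.ofFinite _

/-- The absolute trace `Tr_{2^k/2}`, viewed as an element of `GF k`
(its values lie in the prime field `{0,1}`). -/
def atr (k : ℕ) (x : GF k) : GF k := ∑ j ∈ Finset.range k, x ^ 2 ^ j

/-- `(-1)^b` for `b ∈ {0,1} ⊆ GF k`. -/
def chi (k : ℕ) (x : GF k) : ℤ := if x = 0 then 1 else -1

/-- The Walsh transform of a Boolean-valued function `f` on `GF k`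
(`f` takes values in the prime field `{0,1}`). -/
def walsh (k : ℕ) (f : GF k → GF k) (ω : GF k) : ℤ :=
  ∑ x : GF k, chi k (f x + atr k (ω * x))

/-- The trace `Tr_{2^m/2}` of the subfield `K_m ⊆ GF (2*m)`, viewed inside `GF (2*m)`. -/
def trKm (m : ℕ) (x : GF (2*m)) : GF (2*m) := ∑ j ∈ Finset.range m, x ^ 2 ^ j

/-- The subfield `K_m = {x : x^(2^m) = x}` of `GF (2*m)`, as a finset. -/
def Km (m : ℕ) : Finset (GF (2*m)) := Finset.univ.filter (fun x => x ^ 2 ^ m = x)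

/-- `max_{a ≠ 0, ω} |W_{F_a}(ω)|` for a vectorial function `F` on `GF (2*m)`. -/
def maxAbsW (m : ℕ) (F : GF (2*m) → GF (2*m)) : ℕ :=
  Finset.sup ((Finset.univ.filter (fun a : GF (2*m) => a ≠ 0)) ×ˢ (Finset.univ : Finset (GF (2*m))))
    (fun p => (walsh (2*m) (fun x => atr (2*m) (p.1 * F x)) p.2).natAbs)

/-- The nonlinearity `N_F = 2^(n-1) - (1/2) max_{a ≠ 0, ω} |W_{F_a}(ω)|`, `n = 2m`. -/
def nlin (m : ℕ) (F : GF (2*m) → GF (2*m)) : ℚ :=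
  2 ^ (2*m - 1) - (maxAbsW m F : ℚ) / 2


/-- The square of a quadratic character sum is either zero or the order of the group times the
order of the radical. -/
lemma sq_sum_quadratic {V : Type*} [AddCommGroup V] [Fintype V] (Q : V → ℤ)
    (β : V →+ AddChar V ℤ) (hQ : ∀ x y, Q (x + y) = Q x * Q y * β y x)
    (hsq : ∀ x, Q x * Q x = 1) :
    (∑ x, Q x) ^ 2 = 0 ∨ (∑ x, Q x) ^ 2 = Fintype.card V * Fintype.card β.ker := by
  have hQ0 : Q 0 = 1 := by
    have h0 := hQ 0 0
    rwa [add_zero, hsq, map_zero β, AddChar.zero_apply, one_mul] at h0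
  let χ : AddChar β.ker ℤ :=
    { toFun := fun v => Q v
      map_zero_eq_one' := hQ0
      map_add_eq_mul' := fun v w => by
        have hw : β w = 0 := w.2
        simp [hQ, hw] }
  have key : (∑ x, Q x) ^ 2 = Fintype.card V * ∑ v, χ v := by
    calc (∑ x, Q x) ^ 2 = ∑ x, ∑ v, Q x * Q (x + v) := by
          rw [sq, Finset.sum_mul]
          refine Finset.sum_congr rfl fun x _ => ?_
          rw [Finset.mul_sum]
          exact (Equiv.sum_comp (Equiv.addLeft x) (fun v => Q x * Q v)).symm
      _ = ∑ v, Q v * ∑ x, β v x := by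
          rw [Finset.sum_comm]
          refine Finset.sum_congr rfl fun v _ => ?_
          rw [Finset.mul_sum]
          refine Finset.sum_congr rfl fun x _ => ?_
          rw [hQ, ← mul_assoc, ← mul_assoc, hsq, one_mul]
      _ = ∑ v, if v ∈ β.ker then Q v * Fintype.card V else 0 := by
          refine Finset.sum_congr rfl fun v _ => ?_
          rw [AddChar.sum_eq_ite]
          simp [AddMonoidHom.mem_ker]
      _ = Fintype.card V * ∑ v, χ v := by
          rw [← Finset.sum_filter, ← Finset.sum_subtype_eq_sum_filter, Finset.mul_sum]
          refine Finset.sum_bij (fun v _ => ⟨v.1, v.2⟩) ?_ ?_ ?_ ?_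
          · simp
          · intro v _ w _ hvw
            exact Subtype.ext (congrArg (fun z : β.ker => (z : V)) hvw)
          · intro v _
            exact ⟨⟨v.1, v.2⟩, by simp, rfl⟩
          · intro v _
            exact mul_comm _ _
  rw [AddChar.sum_eq_ite] at key
  split_ifs at key
  · exact Or.inr key
  · exact Or.inl (by simpa using key)

section FiniteField

variable {K : Type*} [Field K]

/-- The polar form `(x, y) ↦ ψ (a (σ x * h y + σ y * h x))` of the quadratic form
`x ↦ a * σ x * h x`, as a homomorphism in `y`. -/
def polarChar (ψ : AddChar K ℤ) (σ : K →+* K) (h : K →+ K) (a : K) : K →+ AddChar K ℤ where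
  toFun y :=
    { toFun := fun x => ψ (a * (σ x * h y + σ y * h x))
      map_zero_eq_one' := by simp
      map_add_eq_mul' := fun x z => by
        rw [← AddChar.map_add_eq_mul]
        congr 1
        simp only [map_add]
        ring }
  map_zero' := by
    ext x
    simp
  map_add' y z := by
    ext x
    simp only [AddChar.coe_mk, AddChar.add_apply]
    rw [← AddChar.map_add_eq_mul]
    congr 1
    simp only [map_add]
    ring

lemma polarChar_apply (ψ : AddChar K ℤ) (σ : K →+* K) (h : K →+ K) (a x y : K) :
    polarChar ψ σ h a y x = ψ (a * (σ x * h y + σ y * h x)) := rfl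

lemma AddChar.mul_self_eq_one_of_charTwo [CharP K 2] (ψ : AddChar K ℤ) (x : K) :
    ψ x * ψ x = 1 := by
  rw [← AddChar.map_add_eq_mul, CharTwo.add_self_eq_zero, AddChar.map_zero_eq_one]

variable [Fintype K]

lemma sq_sum_walsh_quadratic [CharP K 2] (ψ : AddChar K ℤ) (σ : K →+* K) (h : K →+ K)
    (a w : K) :
    (∑ y, ψ (a * (σ y * h y) + w * y)) ^ 2 = 0 ∨
      (∑ y, ψ (a * (σ y * h y) + w * y)) ^ 2 =
        Fintype.card K * Fintype.card (polarChar ψ σ h a).ker := by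
  refine sq_sum_quadratic _ (polarChar ψ σ h a) (fun x y => ?_)
    (fun x => ψ.mul_self_eq_one_of_charTwo _)
  rw [polarChar_apply, ← AddChar.map_add_eq_mul, ← AddChar.map_add_eq_mul]
  congr 1
  simp only [map_add]
  ring

lemma exists_sum_walsh_quadratic_ne_zero {ψ : AddChar K ℤ} (hψ : ψ.IsPrimitive) (σ : K →+* K)
    (h : K →+ K) (a : K) : ∃ w, ∑ y, ψ (a * (σ y * h y) + w * y) ≠ 0 := by
  by_contra! hall
  have hsum : ∑ w, ∑ y, ψ (a * (σ y * h y) + w * y) = Fintype.card K := by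
    rw [Finset.sum_comm]
    have hy : ∀ y, ∑ w, ψ (a * (σ y * h y) + w * y)
        = if y = 0 then (Fintype.card K : ℤ) else 0 := by
      intro y
      simp_rw [AddChar.map_add_eq_mul, ← Finset.mul_sum, AddChar.sum_mulShift y hψ]
      split_ifs with h0
      · simp [h0]
      · simp
    simp [hy]
  simp [hall, eq_comm] at hsum

/-- A non-injective additive endomorphism is annihilated by a nontrivial multiple of a primitive
character. -/
lemma exists_ne_zero_forall_map_mul_eq_one {ψ : AddChar K ℤ} (hψ : ψ.IsPrimitive)
    (g : K →+ K) {y : K} (hy : y ≠ 0) (hgy : g y = 0) :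
    ∃ a, a ≠ 0 ∧ ∀ x, ψ (a * g x) = 1 := by
  by_contra! hall
  let χ : K → AddChar K ℤ := fun a =>
    { toFun := fun x => ψ (a * g x)
      map_zero_eq_one' := by simp
      map_add_eq_mul' := fun x z => by
        rw [← AddChar.map_add_eq_mul, map_add, mul_add] }
  have hχ : ∀ a, ∑ x, ψ (a * g x) = if a = 0 then (Fintype.card K : ℤ) else 0 := by
    intro a
    split_ifs with ha
    · simp [ha]
    · obtain ⟨x, hx⟩ := hall a ha
      have hne : χ a ≠ 0 := fun h0 => hx (DFunLike.congr_fun h0 x)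
      exact AddChar.sum_eq_zero_iff_ne_zero.2 hne
  have hsum : ∑ a, ∑ x, ψ (a * g x) = Fintype.card K := by simp [hχ]
  rw [Finset.sum_comm] at hsum
  simp_rw [AddChar.sum_mulShift _ hψ, Nat.cast_ite, Nat.cast_zero] at hsum
  rw [← Finset.sum_filter, Finset.sum_const, nsmul_eq_mul] at hsum
  have hcard : 1 < (Finset.univ.filter fun x => g x = 0).card :=
    Finset.one_lt_card.2 ⟨y, by simpa using hgy, 0, by simp, hy⟩
  have hpos : (0 : ℤ) < Fintype.card K := by exact_mod_cast Fintype.card_pos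
  have : (1 : ℤ) < (Finset.univ.filter fun x => g x = 0).card := by exact_mod_cast hcard
  nlinarith

lemma exists_one_lt_card_ker_polarChar [CharP K 2] {ψ : AddChar K ℤ} (hψ : ψ.IsPrimitive)
    (σ : K →+* K) (h : K →+ K) :
    ∃ a, a ≠ 0 ∧ 1 < Fintype.card (polarChar ψ σ h a).ker := by
  let g : K →+ K :=
    { toFun := fun x => σ x * h 1 + σ 1 * h x
      map_zero' := by simp
      map_add' := fun x z => by
        simp only [map_add]
        ring }
  obtain ⟨a, ha, hg⟩ := exists_ne_zero_forall_map_mul_eq_one hψ g one_ne_zero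
    (CharTwo.add_self_eq_zero (σ 1 * h 1))
  refine ⟨a, ha, Fintype.one_lt_card_iff.2 ⟨⟨1, ?_⟩, 0, fun h0 => ?_⟩⟩
  · rw [AddMonoidHom.mem_ker]
    ext x
    exact hg x
  · exact one_ne_zero (congrArg Subtype.val h0)

end FiniteField

section Extension

variable {K L : Type*} [Field K] [Fintype K] [Field L] [Fintype L] [Algebra K L]

lemma sum_eq_sum_sum_mul_add {T : L →ₗ[K] K} (hker : ∀ x, T x = 0 ↔ ∃ k, algebraMap K L k = x)
    {u : L} (hu : T u = 1) (f : L → ℤ) :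
    ∑ x, f x = ∑ y : K, ∑ z : K, f (algebraMap K L y * u + algebraMap K L z) := by
  rw [← Fintype.sum_prod_type']
  have hz : ∀ z, T (algebraMap K L z) = 0 := fun z => (hker _).2 ⟨z, rfl⟩
  have hyu : ∀ y, T (algebraMap K L y * u) = y := fun y => by
    rw [← Algebra.smul_def, map_smul, hu, smul_eq_mul, mul_one]
  refine (Function.Bijective.sum_comp
    (e := fun p : K × K => algebraMap K L p.1 * u + algebraMap K L p.2) ⟨?_, ?_⟩ f).symm
  · rintro ⟨y, z⟩ ⟨y', z'⟩ heq
    have hy : y = y' := by simpa [hz, hyu] using congrArg T heq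
    subst hy
    simpa using heq
  · intro x
    obtain ⟨z, hz'⟩ := (hker (x - algebraMap K L (T x) * u)).1 (by rw [map_sub, hyu, sub_self])
    exact ⟨(T x, z), by simp [hz']⟩

variable [CharP L 2]

/-- The Walsh transform of `x ↦ x ^ 2 ^ e * h (T x)`, summed over the fibres of `T`. -/
lemma walsh_sum_eq (ψ : AddChar K ℤ) {T : L →ₗ[K] K}
    (hker : ∀ x, T x = 0 ↔ ∃ k, algebraMap K L k = x) {u : L} (hu : T u = 1) (e : ℕ)
    (h : K →+ K) (a ω : L) :
    ∑ x, ψ (T (a * (x ^ 2 ^ e * algebraMap K L (h (T x))) + ω * x)) =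
      ∑ y : K, ψ (T (a * u ^ 2 ^ e) * (y ^ 2 ^ e * h y) + T (ω * u) * y) *
        ∑ z : K, ψ (T a * h y * z ^ 2 ^ e + T ω * z) := by
  rw [sum_eq_sum_sum_mul_add hker hu]
  have hz : ∀ z, T (algebraMap K L z) = 0 := fun z => (hker _).2 ⟨z, rfl⟩
  have hmul : ∀ y x, T (algebraMap K L y * x) = y * T x := fun y x => by
    rw [← Algebra.smul_def, map_smul, smul_eq_mul]
  refine Finset.sum_congr rfl fun y _ => ?_
  rw [Finset.mul_sum]
  refine Finset.sum_congr rfl fun z _ => ?_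
  rw [← AddChar.map_add_eq_mul]
  congr 1
  rw [map_add T (algebraMap K L y * u), hz, hmul, hu, mul_one, add_zero, add_pow_char_pow, mul_pow,
    ← map_pow, ← map_pow]
  have hsplit : a * ((algebraMap K L (y ^ 2 ^ e) * u ^ 2 ^ e + algebraMap K L (z ^ 2 ^ e)) *
      algebraMap K L (h y)) + ω * (algebraMap K L y * u + algebraMap K L z) =
      algebraMap K L (y ^ 2 ^ e * h y) * (a * u ^ 2 ^ e) + algebraMap K L (h y * z ^ 2 ^ e) * a +
        (algebraMap K L y * (ω * u) + algebraMap K L z * ω) := by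
    simp only [map_mul]
    ring
  rw [hsplit]
  simp only [map_add, hmul]
  ring

lemma abs_walsh_sum_le [CharP K 2] {ψ : AddChar K ℤ} (hψ : ψ.IsPrimitive) {T : L →ₗ[K] K}
    (hker : ∀ x, T x = 0 ↔ ∃ k, algebraMap K L k = x) {u : L} (hu : T u = 1) (e : ℕ)
    {h : K →+ K} (hinj : Function.Injective h) {a : L} (ha : T a ≠ 0) (ω : L) :
    |∑ x, ψ (T (a * (x ^ 2 ^ e * algebraMap K L (h (T x))) + ω * x))| ≤ Fintype.card K := by
  rw [walsh_sum_eq ψ hker hu]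
  let χ : K → AddChar K ℤ := fun y =>
    { toFun := fun z => ψ (T a * h y * z ^ 2 ^ e + T ω * z)
      map_zero_eq_one' := by simp
      map_add_eq_mul' := fun z w => by
        rw [← AddChar.map_add_eq_mul, add_pow_char_pow]
        congr 1
        ring }
  have hsum : ∀ y, ∑ z : K, ψ (T a * h y * z ^ 2 ^ e + T ω * z)
      = if χ y = 0 then (Fintype.card K : ℤ) else 0 := fun y => (χ y).sum_eq_ite
  have hunique : ∀ y y', χ y = 0 → χ y' = 0 → y = y' := by
    intro y y' hy hy'
    by_contra hne
    have hc : T a * (h y - h y') ≠ 0 :=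
      mul_ne_zero ha (sub_ne_zero.2 fun h0 => hne (hinj h0))
    refine hψ hc ?_
    ext t
    obtain ⟨z, rfl⟩ : ∃ z : K, z ^ 2 ^ e = t := by
      obtain ⟨z, hz⟩ := (Finite.injective_iff_surjective.1 (iterateFrobenius_inj K 2 e)) t
      exact ⟨z, hz⟩
    have h1 : ψ (T a * h y * z ^ 2 ^ e + T ω * z) = 1 :=
      DFunLike.congr_fun hy z
    have h2 : ψ (T a * h y' * z ^ 2 ^ e + T ω * z) = 1 :=
      DFunLike.congr_fun hy' z
    have h3 : T a * h y * z ^ 2 ^ e + T ω * z =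
        T a * (h y - h y') * z ^ 2 ^ e + (T a * h y' * z ^ 2 ^ e + T ω * z) := by ring
    rw [h3, AddChar.map_add_eq_mul, h2, mul_one] at h1
    simpa [AddChar.mulShift_apply] using h1
  have habs : ∀ x, |ψ x| = 1 := fun x => by
    rw [← sq_eq_sq₀ (abs_nonneg _) zero_le_one, sq_abs, sq, ψ.mul_self_eq_one_of_charTwo, one_pow]
  calc _ ≤ ∑ y, if χ y = 0 then (Fintype.card K : ℤ) else 0 := by
        refine (Finset.abs_sum_le_sum_abs _ _).trans (Finset.sum_le_sum fun y _ => ?_)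
        rw [abs_mul, habs, one_mul, hsum]
        split_ifs <;> simp
    _ = ((Finset.univ.filter fun y => χ y = 0).card : ℤ) * Fintype.card K := by
        rw [← Finset.sum_filter, Finset.sum_const, nsmul_eq_mul]
    _ ≤ 1 * Fintype.card K := by
        refine mul_le_mul_of_nonneg_right ?_ (by positivity)
        exact_mod_cast Finset.card_le_one.2 fun y hy y' hy' =>
          hunique y y' (by simpa using hy) (by simpa using hy')
    _ = Fintype.card K := one_mul _

lemma walsh_sum_algebraMap {ψ : AddChar K ℤ} (hψ : ψ.IsPrimitive) {T : L →ₗ[K] K}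
    (hker : ∀ x, T x = 0 ↔ ∃ k, algebraMap K L k = x) {u : L} (hu : T u = 1) {e : ℕ}
    (hue : T (u ^ 2 ^ e) = 1) (h : K →+ K) (b : K) (ω : L) :
    ∑ x, ψ (T (algebraMap K L b * (x ^ 2 ^ e * algebraMap K L (h (T x))) + ω * x)) =
      if T ω = 0 then
        Fintype.card K * ∑ y : K, ψ (b * (y ^ 2 ^ e * h y) + T (ω * u) * y) else 0 := by
  have hb : T (algebraMap K L b) = 0 := (hker _).2 ⟨b, rfl⟩
  have hz : ∑ z : K, ψ (T ω * z) = if T ω = 0 then (Fintype.card K : ℤ) else 0 := by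
    simpa only [mul_comm, Nat.cast_ite, Nat.cast_zero] using AddChar.sum_mulShift (T ω) hψ
  rw [walsh_sum_eq ψ hker hu, ← Algebra.smul_def, map_smul, hue, smul_eq_mul, mul_one]
  simp only [hb, zero_mul, zero_add, hz]
  split_ifs
  · rw [← Finset.sum_mul, mul_comm]
  · simp

end Extension

lemma add_pow_two_pow (k j : ℕ) (x y : GF k) : (x + y) ^ 2 ^ j = x ^ 2 ^ j + y ^ 2 ^ j :=
  add_pow_char_pow x y 2 j

lemma pow_two_pow_two_mul {m : ℕ} (hm : m ≠ 0) (x : GF (2 * m)) : x ^ 2 ^ (2 * m) = x := by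
  have hcard : Fintype.card (GF (2 * m)) = 2 ^ (2 * m) := by
    rw [← Nat.card_eq_fintype_card]
    exact GaloisField.card 2 (2 * m) (by omega)
  have hx := FiniteField.pow_card x
  rwa [hcard] at hx

lemma atr_add (k : ℕ) (x y : GF k) : atr k (x + y) = atr k x + atr k y := by
  simp only [atr, add_pow_two_pow, Finset.sum_add_distrib]

lemma trKm_add (m : ℕ) (x y : GF (2 * m)) : trKm m (x + y) = trKm m x + trKm m y := by
  simp only [trKm, add_pow_two_pow, Finset.sum_add_distrib]

lemma atr_eq_trKm (m : ℕ) (x : GF (2 * m)) : atr (2 * m) x = trKm m (x + x ^ 2 ^ m) := by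
  have hsplit : Finset.range (2 * m) = Finset.range (m + m) := by rw [two_mul]
  rw [trKm_add, atr, hsplit, Finset.sum_range_add, trKm, trKm]
  simp only [← pow_mul, ← pow_add]

lemma exists_atr_ne_zero {k : ℕ} (hk : k ≠ 0) : ∃ x, atr k x ≠ 0 := by
  obtain ⟨x, hx⟩ := Algebra.trace_surjective (ZMod 2) (GF k) 1
  refine ⟨x, fun h0 => ?_⟩
  have htr := FiniteField.algebraMap_trace_eq_sum_pow (ZMod 2) (GF k) x
  rw [GaloisField.finrank 2 hk, Nat.card_zmod, hx, map_one] at htr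
  exact one_ne_zero (htr.trans h0)

lemma trKm_sq {m : ℕ} {x : GF (2 * m)} (hx : x ^ 2 ^ m = x) : trKm m x ^ 2 = trKm m x := by
  have hsq : trKm m x ^ 2 = ∑ j ∈ Finset.range m, x ^ 2 ^ (j + 1) := by
    rw [trKm, sum_pow_char]
    simp only [← pow_mul, ← pow_succ]
  have h1 := Finset.sum_range_succ (fun j => x ^ 2 ^ j) m
  have h2 := Finset.sum_range_succ' (fun j => x ^ 2 ^ j) m
  rw [h1, hx, pow_zero, pow_one] at h2
  rw [hsq]
  exact (add_right_cancel h2).symm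

lemma chi_add {k : ℕ} {p q : GF k} (hp : p ^ 2 = p) (hq : q ^ 2 = q) :
    chi k (p + q) = chi k p * chi k q := by
  have h01 : ∀ {t : GF k}, t ^ 2 = t → t = 0 ∨ t = 1 := fun {t} ht => by
    have : t * (t - 1) = 0 := by rw [mul_sub, ← sq, ht, mul_one, sub_self]
    exact (mul_eq_zero.1 this).imp_right sub_eq_zero.1
  have h11 : (1 : GF k) + 1 = 0 := CharTwo.add_self_eq_zero 1
  rcases h01 hp with rfl | rfl <;> rcases h01 hq with rfl | rfl <;> simp [chi, h11]

lemma chi_eq_one_iff {k : ℕ} {x : GF k} : chi k x = 1 ↔ x = 0 := by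
  unfold chi
  split_ifs with h0 <;> simp [h0]

/-- The subfield `K_m`, bundled. -/
def subfieldKm (m : ℕ) : Subfield (GF (2 * m)) :=
  (iterateFrobenius (GF (2 * m)) 2 m).eqLocusField (RingHom.id _)

lemma mem_subfieldKm {m : ℕ} {x : GF (2 * m)} : x ∈ subfieldKm m ↔ x ^ 2 ^ m = x := Iff.rfl

/-- The relative trace from `GF (2 * m)` to `K_m`. -/
def relTrace (m : ℕ) (hm : m ≠ 0) : GF (2 * m) →ₗ[subfieldKm m] subfieldKm m where
  toFun x := ⟨x + x ^ 2 ^ m, by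
    rw [mem_subfieldKm, add_pow_two_pow, ← pow_mul, ← pow_add, ← two_mul,
      pow_two_pow_two_mul hm, add_comm]⟩
  map_add' x y := by
    ext
    simp only [add_pow_two_pow, Subfield.coe_add]
    ring
  map_smul' c x := by
    ext
    have hc : (c : GF (2 * m)) ^ 2 ^ m = c := c.2
    simp only [Subfield.smul_def, smul_eq_mul, mul_pow, hc, RingHom.id_apply, Subfield.coe_mul]
    ring

lemma coe_relTrace {m : ℕ} (hm : m ≠ 0) (x : GF (2 * m)) :
    (relTrace m hm x : GF (2 * m)) = x + x ^ 2 ^ m := rfl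

lemma relTrace_eq_zero_iff {m : ℕ} (hm : m ≠ 0) (x : GF (2 * m)) :
    relTrace m hm x = 0 ↔ ∃ k, algebraMap (subfieldKm m) (GF (2 * m)) k = x := by
  rw [← Subtype.coe_inj, coe_relTrace, Subfield.coe_zero, CharTwo.add_eq_zero]
  constructor
  · intro hx
    exact ⟨⟨x, hx.symm⟩, rfl⟩
  · rintro ⟨k, rfl⟩
    exact (mem_subfieldKm.1 k.2).symm

lemma card_subfieldKm_le {m : ℕ} (hm : m ≠ 0) : Nat.card (subfieldKm m) ≤ 2 ^ m := by
  have hlt : 1 < 2 ^ m := Nat.one_lt_two_pow hm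
  have hne := FiniteField.X_pow_card_sub_X_ne_zero (GF (2 * m)) hlt
  have hsub : (Finset.univ.filter fun x => x ∈ subfieldKm m) ⊆
      (Polynomial.X ^ 2 ^ m - Polynomial.X : Polynomial (GF (2 * m))).roots.toFinset := by
    intro x hx
    have hx' : x ^ 2 ^ m = x := by simpa [mem_subfieldKm] using hx
    simp [hne, hx']
  calc Nat.card (subfieldKm m) = (Finset.univ.filter fun x => x ∈ subfieldKm m).card := by
        rw [Nat.card_eq_fintype_card]
        exact Fintype.card_subtype _
    _ ≤ _ := Finset.card_le_card hsub
    _ ≤ _ := Multiset.toFinset_card_le _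
    _ ≤ _ := Polynomial.card_roots' _
    _ = 2 ^ m := FiniteField.X_pow_card_sub_X_natDegree_eq _ hlt

lemma card_mul_card_range_relTrace {m : ℕ} (hm : m ≠ 0) :
    Nat.card (subfieldKm m) * Nat.card (relTrace m hm).toAddMonoidHom.range = 2 ^ m * 2 ^ m := by
  have hker : Nat.card (relTrace m hm).toAddMonoidHom.ker = Nat.card (subfieldKm m) := by
    refine Nat.card_congr (Equiv.subtypeEquivRight fun x => ?_)
    rw [AddMonoidHom.mem_ker]
    refine (relTrace_eq_zero_iff hm x).trans ⟨?_, fun hx => ⟨⟨x, hx⟩, rfl⟩⟩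
    rintro ⟨k, rfl⟩
    exact k.2
  rw [← hker, ← AddSubgroup.index_ker, AddSubgroup.card_mul_index, GaloisField.card 2 _ (by omega),
    two_mul, pow_add]

lemma card_subfieldKm {m : ℕ} (hm : m ≠ 0) : Nat.card (subfieldKm m) = 2 ^ m := by
  refine (card_subfieldKm_le hm).antisymm ?_
  have hle := Nat.card_le_card_of_injective _
    (relTrace m hm).toAddMonoidHom.range.subtype_injective
  have := card_mul_card_range_relTrace hm
  nlinarith

lemma relTrace_surjective {m : ℕ} (hm : m ≠ 0) : Function.Surjective (relTrace m hm) := by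
  have hmul := card_mul_card_range_relTrace hm
  rw [card_subfieldKm hm] at hmul
  have hrange := Nat.eq_of_mul_eq_mul_left (by positivity) hmul
  exact AddMonoidHom.range_eq_top.1
    (AddSubgroup.eq_top_of_card_eq _ (hrange.trans (card_subfieldKm hm).symm))

/-- The canonical additive character `x ↦ (-1) ^ Tr x` of `K_m`. -/
def charKm (m : ℕ) : AddChar (subfieldKm m) ℤ where
  toFun x := chi (2 * m) (trKm m x)
  map_zero_eq_one' := by
    rw [chi_eq_one_iff]
    simp [trKm]
  map_add_eq_mul' x y := by
    rw [Subfield.coe_add, trKm_add, chi_add (trKm_sq x.2) (trKm_sq y.2)]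

lemma charKm_eq_one_iff {m : ℕ} {x : subfieldKm m} :
    charKm m x = 1 ↔ trKm m x = 0 := chi_eq_one_iff

lemma charKm_isPrimitive {m : ℕ} (hm : m ≠ 0) : (charKm m).IsPrimitive := by
  refine AddChar.IsPrimitive.of_ne_one fun h0 => ?_
  obtain ⟨x, hx⟩ := exists_atr_ne_zero (k := 2 * m) (by omega)
  refine hx ((atr_eq_trKm m x).trans (charKm_eq_one_iff (x := relTrace m hm x).1 ?_))
  rw [h0, AddChar.one_apply]

lemma walsh_eq_sum_charKm {m : ℕ} (hm : m ≠ 0) (e : ℕ) {h : GF (2 * m) → GF (2 * m)}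
    {g : subfieldKm m → subfieldKm m} (hg : ∀ x, (g x : GF (2 * m)) = h x) (a ω : GF (2 * m)) :
    walsh (2 * m) (fun x => atr (2 * m) (a * (x ^ 2 ^ e * h (x + x ^ 2 ^ m)))) ω =
      ∑ x, charKm m (relTrace m hm
        (a * (x ^ 2 ^ e * algebraMap (subfieldKm m) (GF (2 * m)) (g (relTrace m hm x))) +
          ω * x)) := by
  refine Finset.sum_congr rfl fun x _ => ?_
  rw [← atr_add, atr_eq_trKm, ← coe_relTrace hm x, ← hg]
  rfl

lemma card_radical_eq {m : ℕ} (e : ℕ) {h : GF (2 * m) → GF (2 * m)}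
    {g : subfieldKm m →+ subfieldKm m} (hg : ∀ x, (g x : GF (2 * m)) = h x) (a : subfieldKm m) :
    ((Km m).filter (fun y => ∀ x ∈ Km m,
      trKm m (a * (x ^ 2 ^ e * h y + y ^ 2 ^ e * h x)) = 0)).card =
      Fintype.card (polarChar (charKm m) (iterateFrobenius _ 2 e) g a).ker := by
  have hmem : ∀ y : subfieldKm m, y ∈ (polarChar (charKm m) (iterateFrobenius _ 2 e) g a).ker ↔
      ∀ x ∈ Km m, trKm m (a * (x ^ 2 ^ e * h y + (y : GF (2 * m)) ^ 2 ^ e * h x)) = 0 := by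
    intro y
    rw [AddMonoidHom.mem_ker, DFunLike.ext_iff]
    constructor
    · intro hy x hx
      have hx' : x ∈ subfieldKm m := by simpa [Km, mem_subfieldKm] using hx
      have := charKm_eq_one_iff.1 (hy ⟨x, hx'⟩)
      simpa [iterateFrobenius_def, hg] using this
    · intro hy x
      refine charKm_eq_one_iff.2 ?_
      have := hy x (by simpa [Km] using mem_subfieldKm.1 x.2)
      simpa [iterateFrobenius_def, hg] using this
  symm
  rw [← Finset.card_univ]
  refine Finset.card_bij (fun y _ => ((y : subfieldKm m) : GF (2 * m))) ?_ ?_ ?_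
  · intro y _
    rw [Finset.mem_filter]
    exact ⟨by simpa [Km] using mem_subfieldKm.1 y.1.2, (hmem y).1 y.2⟩
  · intro y _ z _ hyz
    exact Subtype.ext (Subtype.ext hyz)
  · intro y hy
    rw [Finset.mem_filter] at hy
    have hyK : y ∈ subfieldKm m := by simpa [Km, mem_subfieldKm] using hy.1
    exact ⟨⟨⟨y, hyK⟩, (hmem ⟨y, hyK⟩).2 hy.2⟩, Finset.mem_univ _, rfl⟩

lemma natAbs_eq_two_pow_of_sq_eq {s : ℤ} {m r : ℕ} (hr : r ≤ m)
    (hs : s ^ 2 = 2 ^ m * 2 ^ (m - r)) : Even r ∧ s.natAbs = 2 ^ (m - r / 2) := by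
  have hnat : s.natAbs ^ 2 = 2 ^ (2 * m - r) := by
    zify
    rw [sq_abs, hs, ← pow_add]
    congr 1
    omega
  obtain ⟨j, -, hj⟩ := (Nat.dvd_prime_pow Nat.prime_two).1 (hnat ▸ dvd_pow_self _ two_ne_zero)
  rw [hj, ← pow_mul] at hnat
  have hexp := Nat.pow_right_injective le_rfl hnat
  refine ⟨⟨m - j, by omega⟩, ?_⟩
  rw [hj]
  congr 1
  omega

/-- for `h` an `F_2`-linear bijection of `K_m` and
`F(x) = x^(2^e)·h(Tr_{2^n/2^m}(x))`, with `r_a` the rank of the quadratic form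
`H_a(x) = Tr_{2^m/2}(a·x^(2^e)h(x))` (encoded via the cardinality `2^(m−r_a)` of its
radical), `E = {a ∈ K_m \ {0} : r_a even}` nonempty and `r = min_{a∈E} r_a`:
`N_F = 2^(n−1) − 2^(n−r/2−1)`, `N_F ≤ 2^(n−1) − 2^⌊3n/4⌋`, with equality iff
`r = m−2` when `m` even, resp. `r = m−1` when `m` odd. -/
theorem stmt4 (m : ℕ) (hm : 1 ≤ m) (e : ℕ)
    (h : GF (2*m) → GF (2*m))
    (hbij : Set.BijOn h {x : GF (2*m) | x ^ 2 ^ m = x} {x : GF (2*m) | x ^ 2 ^ m = x})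
    (hlin : ∀ x y : GF (2*m), x ^ 2 ^ m = x → y ^ 2 ^ m = y → h (x + y) = h x + h y)
    (r : GF (2*m) → ℕ)
    (hr : ∀ a : GF (2*m), a ^ 2 ^ m = a → a ≠ 0 → r a ≤ m ∧
      ((Km m).filter (fun y => ∀ x ∈ Km m,
          trKm m (a * (x ^ 2 ^ e * h y + y ^ 2 ^ e * h x)) = 0)).card = 2 ^ (m - r a))
    (E : Finset (GF (2*m)))
    (hE : E = (Km m).filter (fun a => a ≠ 0 ∧ Even (r a)))
    (hEne : E.Nonempty)
    (rmin : ℕ) (hrmin : rmin = (E.image r).min' (hEne.image r)) :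
    nlin m (fun x => x ^ 2 ^ e * h (x + x ^ 2 ^ m))
        = 2 ^ (2*m - 1) - 2 ^ (2*m - rmin / 2 - 1) ∧
    nlin m (fun x => x ^ 2 ^ e * h (x + x ^ 2 ^ m))
        ≤ 2 ^ (2*m - 1) - 2 ^ ((3 * (2*m)) / 4) ∧
    (nlin m (fun x => x ^ 2 ^ e * h (x + x ^ 2 ^ m))
        = 2 ^ (2*m - 1) - 2 ^ ((3 * (2*m)) / 4)
      ↔ rmin = if Even m then m - 2 else m - 1) := by
  have hm0 : m ≠ 0 := by omega
  let g : subfieldKm m →+ subfieldKm m :=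
    AddMonoidHom.mk' (fun x => ⟨h x, hbij.mapsTo x.2⟩)
      fun x y => Subtype.ext (hlin x y x.2 y.2)
  have hg : ∀ x, (g x : GF (2 * m)) = h x := fun _ => rfl
  have hginj : Function.Injective g := fun x y hxy =>
    Subtype.ext (hbij.injOn x.2 y.2 (congrArg Subtype.val hxy))
  have hψ := charKm_isPrimitive hm0
  have hcard : Fintype.card (subfieldKm m) = 2 ^ m := by
    rw [← Nat.card_eq_fintype_card, card_subfieldKm hm0]
  obtain ⟨u, hu⟩ := relTrace_surjective hm0 1
  have hue : relTrace m hm0 (u ^ 2 ^ e) = 1 := by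
    have hpow : relTrace m hm0 (u ^ 2 ^ e) = relTrace m hm0 u ^ 2 ^ e := by
      ext
      rw [SubmonoidClass.coe_pow, coe_relTrace, coe_relTrace, add_pow_two_pow, pow_right_comm]
    rw [hpow, hu, one_pow]
  set S : subfieldKm m → subfieldKm m → ℤ := fun b w =>
    ∑ y, charKm m (b * (y ^ 2 ^ e * g y) + w * y) with hS
  have hker : ∀ b : subfieldKm m, b ≠ 0 → r b ≤ m ∧
      Fintype.card (polarChar (charKm m) (iterateFrobenius _ 2 e) g b).ker = 2 ^ (m - r b) := by
    intro b hb
    have hrb := hr b b.2 (fun h0 => hb (Subtype.ext h0))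
    exact ⟨hrb.1, (card_radical_eq e hg b).symm.trans hrb.2⟩
  have hSval : ∀ b : subfieldKm m, b ≠ 0 → ∀ w, S b w ≠ 0 →
      Even (r b) ∧ (S b w).natAbs = 2 ^ (m - r b / 2) := by
    intro b hb w hw
    obtain ⟨hle, hcardker⟩ := hker b hb
    have hsq := (sq_sum_walsh_quadratic (charKm m) (iterateFrobenius _ 2 e) g b w).resolve_left
      (pow_ne_zero 2 hw)
    rw [hcard, hcardker] at hsq
    exact natAbs_eq_two_pow_of_sq_eq hle (by exact_mod_cast hsq)
  have hSne : ∀ b, ∃ w, S b w ≠ 0 := fun b =>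
    exists_sum_walsh_quadratic_ne_zero hψ (iterateFrobenius _ 2 e) g b
  have hmemE : ∀ b : subfieldKm m, b ≠ 0 → (b : GF (2 * m)) ∈ E := by
    intro b hb
    obtain ⟨w, hw⟩ := hSne b
    rw [hE, Finset.mem_filter]
    exact ⟨by simpa [Km] using mem_subfieldKm.1 b.2, fun h0 => hb (Subtype.ext h0),
      (hSval b hb w hw).1⟩
  have hrle : ∀ b : subfieldKm m, b ≠ 0 → rmin ≤ r b := fun b hb => by
    rw [hrmin]
    exact Finset.min'_le _ _ (Finset.mem_image_of_mem r (hmemE b hb))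
  obtain ⟨b₀, hb₀, hrb₀, hev⟩ : ∃ b : subfieldKm m, b ≠ 0 ∧ r b = rmin ∧ Even rmin := by
    obtain ⟨a, ha, har⟩ := Finset.mem_image.1 (Finset.min'_mem _ (hEne.image r))
    rw [← hrmin] at har
    rw [hE, Finset.mem_filter] at ha
    refine ⟨⟨a, by simpa [Km, mem_subfieldKm] using ha.1⟩, fun h0 => ha.2.1 ?_, har, har ▸ ha.2.2⟩
    exact congrArg Subtype.val h0
  have hlt : rmin < m := by
    obtain ⟨b, hb, hone⟩ := exists_one_lt_card_ker_polarChar hψ (iterateFrobenius _ 2 e) g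
    rw [(hker b hb).2] at hone
    have hne : m - r b ≠ 0 := fun h0 => by simp [h0] at hone
    have := hrle b hb
    omega
  have hmax : maxAbsW m (fun x => x ^ 2 ^ e * h (x + x ^ 2 ^ m)) = 2 ^ (2 * m - rmin / 2) := by
    apply le_antisymm
    · refine Finset.sup_le fun p hp => ?_
      obtain ⟨a, ω⟩ := p
      have ha : a ≠ 0 := by simpa using hp
      simp only [walsh_eq_sum_charKm hm0 e hg]
      by_cases hTa : relTrace m hm0 a = 0
      · obtain ⟨b, rfl⟩ := (relTrace_eq_zero_iff hm0 a).1 hTa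
        have hb : b ≠ 0 := fun h0 => ha (by rw [h0, map_zero])
        rw [walsh_sum_algebraMap hψ (relTrace_eq_zero_iff hm0) hu hue]
        split_ifs
        · by_cases hw : S b (relTrace m hm0 (ω * u)) = 0
          · simp only [hS] at hw
            simp [hw]
          · rw [Int.natAbs_mul, (hSval b hb _ hw).2, hcard, Int.natAbs_natCast, ← pow_add]
            refine Nat.pow_le_pow_right two_pos ?_
            have := hrle b hb
            have := (hker b hb).1
            omega
        · simp
      · have hle := abs_walsh_sum_le hψ (relTrace_eq_zero_iff hm0) hu e hginj hTa ω
        rw [hcard, Int.abs_eq_natAbs, Nat.cast_le] at hle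
        exact hle.trans (Nat.pow_le_pow_right two_pos (by omega))
    · obtain ⟨w, hw⟩ := hSne b₀
      have hne : (b₀ : GF (2 * m)) ≠ 0 := fun h0 => hb₀ (Subtype.ext h0)
      refine le_trans (le_of_eq ?_) (Finset.le_sup
        (b := ((b₀ : GF (2 * m)), (w : GF (2 * m)))) (by simpa using hne))
      simp only [walsh_eq_sum_charKm hm0 e hg]
      have hTw : relTrace m hm0 w = 0 := (relTrace_eq_zero_iff hm0 _).2 ⟨w, rfl⟩
      have hTwu : relTrace m hm0 (w * u) = w := by
        have := map_smul (relTrace m hm0) w u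
        rwa [hu, smul_eq_mul, mul_one] at this
      have hW := walsh_sum_algebraMap hψ (relTrace_eq_zero_iff hm0) hu hue g b₀ (w : GF (2 * m))
      rw [if_pos hTw, hTwu] at hW
      refine Eq.trans ?_ (congrArg Int.natAbs hW).symm
      rw [Int.natAbs_mul, (hSval b₀ hb₀ w hw).2, hcard, Int.natAbs_natCast, ← pow_add, hrb₀]
      congr 1
      omega
  have hnlin : nlin m (fun x => x ^ 2 ^ e * h (x + x ^ 2 ^ m))
      = 2 ^ (2*m - 1) - 2 ^ (2*m - rmin / 2 - 1) := by
    obtain ⟨k, hk⟩ : ∃ k, 2 * m - rmin / 2 = k + 1 := ⟨2 * m - rmin / 2 - 1, by omega⟩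
    rw [nlin, hmax, hk, Nat.add_sub_cancel, Nat.cast_pow, pow_succ]
    norm_num
  obtain ⟨t, ht⟩ := hev
  refine ⟨hnlin, ?_, ?_⟩
  · rw [hnlin]
    refine sub_le_sub_left (pow_le_pow_right₀ one_le_two ?_) _
    omega
  · rw [hnlin, sub_right_inj, pow_right_inj₀ two_pos (by norm_num)]
    split_ifs with hpar
    · obtain ⟨s, hs⟩ := hpar
      omega
    · obtain ⟨s, hs⟩ := Nat.not_even_iff_odd.1 hpar
      omega
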